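/- arXiv:2110.05461 — 3 statements merged into one kernel-verified Lean document; each statement's English description precedes it below -/
import Mathlib

section
/- For every real β, Re F^IG4(β) = (cos β - 1)⁴(cos β - 5)/(12(5cos β + 7)²) ≤ 0, with equality if and only if cos β = 1; hence the IG4 scheme is dissipative at every wavenumber. -/
/-- The Fourier symbol of the IG4 scheme. -/
noncomputable def FIG4 (β : ℝ) : ℂ :=
  (((Real.cos β - 1) ^ 2 *
      ((Real.cos β) ^ 3 - 7 * (Real.cos β) ^ 2 + 11 * Real.cos β - 5) /
      (12 * (5 * Real.cos β + 7) ^ 2) : ℝ) : ℂ) -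
    Complex.I *
      ((Real.sin β *
        ((Real.cos β) ^ 4 - 8 * (Real.cos β) ^ 3 + 78 * (Real.cos β) ^ 2 +
          728 * Real.cos β + 929) /
        (12 * (5 * Real.cos β + 7) ^ 2) : ℝ) : ℂ)

theorem FIG4_re (β : ℝ) :
    (FIG4 β).re =
      (Real.cos β - 1) ^ 4 * (Real.cos β - 5) / (12 * (5 * Real.cos β + 7) ^ 2) := by
  rw [FIG4, Complex.sub_re, Complex.ofReal_re, Complex.re_mul_ofReal, Complex.I_re, zero_mul,
    sub_zero]
  congr 1
  ring

/-- The IG4 scheme is dissipative at every wavenumber: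
Re F^IG4(β) = (cos β - 1)⁴(cos β - 5)/(12(5cos β + 7)²) ≤ 0,
with equality iff cos β = 1. -/
theorem ig4_dissipative (β : ℝ) :
    (FIG4 β).re =
      (Real.cos β - 1) ^ 4 * (Real.cos β - 5) / (12 * (5 * Real.cos β + 7) ^ 2) ∧
    (FIG4 β).re ≤ 0 ∧
    ((FIG4 β).re = 0 ↔ Real.cos β = 1) := by
  have hden : 0 < 12 * (5 * Real.cos β + 7) ^ 2 := by
    have : 0 < 5 * Real.cos β + 7 := by linarith [Real.neg_one_le_cos β]
    positivity
  have hneg : Real.cos β - 5 < 0 := by linarith [Real.cos_le_one β]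
  refine ⟨FIG4_re β, ?_, ?_⟩
  · rw [FIG4_re]
    exact div_nonpos_of_nonpos_of_nonneg
      (mul_nonpos_of_nonneg_of_nonpos (by positivity) hneg.le) hden.le
  · rw [FIG4_re, div_eq_zero_iff, or_iff_left hden.ne', mul_eq_zero, or_iff_left hneg.ne,
      pow_eq_zero_iff four_ne_zero, sub_eq_zero]
end

section
/- Let F^IG6(β) = (cos β - 1)²(cos³β - 7cos²β + 26cos β - 20)/(108(2cos β + 3)²) - i sin β (cos⁴β - 8cos³β + 105cos²β + 1070cos β + 1532)/(108(2cos β + 3)²). Then the limit as β → 0 (β real, β ≠ 0) of (F^IG6(β) + iβ)/β⁵ equals -i/720; in particular the IG6 scheme is fourth-order accurate for linear advection with a leading fourth-order dispersive error. -/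
open Filter Topology

/-- The Fourier symbol of the IG6 scheme. -/
noncomputable def FIG6 (β : ℝ) : ℂ :=
  (((Real.cos β - 1) ^ 2 *
      ((Real.cos β) ^ 3 - 7 * (Real.cos β) ^ 2 + 26 * Real.cos β - 20) /
      (108 * (2 * Real.cos β + 3) ^ 2) : ℝ) : ℂ) -
    Complex.I *
      ((Real.sin β *
        ((Real.cos β) ^ 4 - 8 * (Real.cos β) ^ 3 + 105 * (Real.cos β) ^ 2 +
          1070 * Real.cos β + 1532) /
        (108 * (2 * Real.cos β + 3) ^ 2) : ℝ) : ℂ)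

/-- A quotient by a power of the variable has the limit given by the quotient of derivatives. -/
theorem tendsto_div_pow_succ_of_hasDerivAt {f f' : ℝ → ℝ} {L : ℝ} (n : ℕ)
    (hf : ∀ x, HasDerivAt f (f' x) x) (h0 : f 0 = 0)
    (h : Tendsto (fun x => f' x / x ^ n) (𝓝[≠] 0) (𝓝 L)) :
    Tendsto (fun x => f x / x ^ (n + 1)) (𝓝[≠] 0) (𝓝 (L / (n + 1))) := by
  have hn : (n : ℝ) + 1 ≠ 0 := by positivity
  refine HasDerivAt.lhopital_zero_nhdsNE (f' := f') (g' := fun x => ((n : ℝ) + 1) * x ^ n)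
    (Eventually.of_forall hf) (Eventually.of_forall fun x => ?_) ?_ ?_ ?_ ?_
  · simpa using hasDerivAt_pow (n + 1) x
  · filter_upwards [self_mem_nhdsWithin] with x hx
    exact mul_ne_zero hn (pow_ne_zero n hx)
  · have := (hf 0).continuousAt.tendsto
    rw [h0] at this
    exact this.mono_left nhdsWithin_le_nhds
  · have : Continuous fun x : ℝ => x ^ (n + 1) := by fun_prop
    simpa using (this.tendsto 0).mono_left nhdsWithin_le_nhds
  · refine (h.div_const ((n : ℝ) + 1)).congr fun x => ?_
    rw [div_div, mul_comm]

theorem tendsto_one_sub_cos_div_sq :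
    Tendsto (fun x : ℝ => (1 - Real.cos x) / x ^ 2) (𝓝[≠] 0) (𝓝 (1 / 2)) := by
  have h1 : Tendsto (fun x : ℝ => Real.sin x / x ^ 1) (𝓝[≠] 0) (𝓝 1) := by
    have := tendsto_div_pow_succ_of_hasDerivAt 0 Real.hasDerivAt_sin Real.sin_zero
      (L := 1) (by
        simpa using (Real.continuous_cos.tendsto 0).mono_left nhdsWithin_le_nhds)
    simpa using this
  have h2 := tendsto_div_pow_succ_of_hasDerivAt (f := fun x => 1 - Real.cos x) 1
    (fun x => by simpa using (Real.hasDerivAt_cos x).const_sub 1) (by simp) h1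
  convert h2 using 2
  norm_num

theorem tendsto_cos_remainder_div_pow_four :
    Tendsto (fun x : ℝ => (x ^ 2 / 2 - (1 - Real.cos x)) / x ^ 4) (𝓝[≠] 0) (𝓝 (1 / 24)) := by
  have h3 := tendsto_div_pow_succ_of_hasDerivAt (f := fun x => x - Real.sin x) 2
    (fun x => (hasDerivAt_id x).sub (Real.hasDerivAt_sin x)) (by simp)
    tendsto_one_sub_cos_div_sq
  have h4 := tendsto_div_pow_succ_of_hasDerivAt
    (f := fun x => x ^ 2 / 2 - (1 - Real.cos x)) 3
    (fun x => by
      refine (((hasDerivAt_pow 2 x).div_const 2).sub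
        ((Real.hasDerivAt_cos x).const_sub 1)).congr_deriv ?_
      push_cast
      ring) (by simp) h3
  convert h4 using 2
  norm_num

theorem tendsto_sin_remainder_div_pow_five :
    Tendsto (fun x : ℝ => (Real.sin x - x + x ^ 3 / 6) / x ^ 5) (𝓝[≠] 0) (𝓝 (1 / 120)) := by
  have h5 := tendsto_div_pow_succ_of_hasDerivAt
    (f := fun x => Real.sin x - x + x ^ 3 / 6) 4
    (fun x => by
      refine (((Real.hasDerivAt_sin x).sub (hasDerivAt_id x)).add
        ((hasDerivAt_pow 3 x).div_const 6)).congr_deriv ?_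
      push_cast
      ring) (by simp) tendsto_cos_remainder_div_pow_four
  convert h5 using 2
  norm_num

/-- The dissipative part of the IG6 symbol is `o(β ^ 5)`. -/
theorem tendsto_ig6_dissipation :
    Tendsto (fun β : ℝ => (Real.cos β - 1) ^ 2 *
      ((Real.cos β) ^ 3 - 7 * (Real.cos β) ^ 2 + 26 * Real.cos β - 20) /
      (108 * (2 * Real.cos β + 3) ^ 2) / β ^ 5) (𝓝[≠] 0) (𝓝 0) := by
  have hx : Tendsto (fun β : ℝ => β) (𝓝[≠] 0) (𝓝 0) := nhdsWithin_le_nhds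
  have hc : Tendsto Real.cos (𝓝[≠] 0) (𝓝 1) := by
    simpa using (Real.continuous_cos.tendsto 0).mono_left nhdsWithin_le_nhds
  have hv := tendsto_one_sub_cos_div_sq
  have key := ((hx.mul (hv.pow 3)).mul
    (((hc.pow 2).sub (hc.const_mul 6)).add_const 20)).neg.div
    ((((hc.const_mul 2).add_const 3).pow 2).const_mul 108) (by norm_num)
  refine (key.congr' ?_).trans_eq (by norm_num)
  filter_upwards [self_mem_nhdsWithin] with β hβ
  have hβ' : β ≠ 0 := hβ
  have hD : 2 * Real.cos β + 3 ≠ 0 := by linarith [Real.neg_one_le_cos β]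
  simp only [Pi.div_apply]
  field_simp
  ring

/-- The dispersive part of the IG6 symbol is `β + β ^ 5 / 720 + o(β ^ 5)`. -/
theorem tendsto_ig6_dispersion :
    Tendsto (fun β : ℝ => (Real.sin β *
      ((Real.cos β) ^ 4 - 8 * (Real.cos β) ^ 3 + 105 * (Real.cos β) ^ 2 +
        1070 * Real.cos β + 1532) / (108 * (2 * Real.cos β + 3) ^ 2) - β) / β ^ 5)
      (𝓝[≠] 0) (𝓝 (1 / 720)) := by
  have hx : Tendsto (fun β : ℝ => β) (𝓝[≠] 0) (𝓝 0) := nhdsWithin_le_nhds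
  have hc : Tendsto Real.cos (𝓝[≠] 0) (𝓝 1) := by
    simpa using (Real.continuous_cos.tendsto 0).mono_left nhdsWithin_le_nhds
  have hv := tendsto_one_sub_cos_div_sq
  have he := tendsto_sin_remainder_div_pow_five
  have hf := tendsto_cos_remainder_div_pow_four
  obtain ⟨g, hg⟩ : ∃ g : ℝ → ℝ, g = fun β =>
      -((β ^ 2 / 2 - (1 - Real.cos β)) / β ^ 4) / 3 +
        5 / 36 * ((1 - Real.cos β) / β ^ 2) ^ 2 +
        β ^ 2 * ((1 - Real.cos β) / β ^ 2) ^ 3 * (101 + 59 * Real.cos β) /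
          (108 * (2 * Real.cos β + 3) ^ 2) := ⟨_, rfl⟩
  have hgl : Tendsto g (𝓝[≠] 0) (𝓝 (1 / 48)) := by
    have := ((hf.neg.div_const 3).add ((hv.pow 2).const_mul (5 / 36))).add
      ((((hx.pow 2).mul (hv.pow 3)).mul ((hc.const_mul 59).const_add 101)).div
        ((((hc.const_mul 2).add_const 3).pow 2).const_mul 108) (by norm_num))
    rw [hg]
    exact this.trans_eq (by norm_num)
  have key := ((hgl.add he).sub_const (1 / 36)).add
    (((hx.pow 2).mul ((he.sub hgl).div_const 6)).add ((hx.pow 4).mul (he.mul hgl)))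
  refine (key.congr' ?_).trans_eq (by norm_num)
  filter_upwards [self_mem_nhdsWithin] with β hβ
  have hβ' : β ≠ 0 := hβ
  have hD : 2 * Real.cos β + 3 ≠ 0 := by linarith [Real.neg_one_le_cos β]
  have hR : ((Real.cos β) ^ 4 - 8 * (Real.cos β) ^ 3 + 105 * (Real.cos β) ^ 2 +
      1070 * Real.cos β + 1532) / (108 * (2 * Real.cos β + 3) ^ 2) =
      1 + β ^ 2 / 6 + β ^ 4 * g β := by
    simp only [hg]
    rw [mul_comm 2 (Real.cos β)] at hD ⊢
    field_simp
    ring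
  rw [mul_div_assoc, hR]
  field_simp
  ring

/-- The IG6 scheme is fourth-order accurate for linear advection with a leading
fourth-order dispersive error: (F^IG6(β) + iβ)/β⁵ → -i/720. -/
theorem ig6_fourth_order :
    Tendsto (fun β : ℝ => (FIG6 β + Complex.I * (β : ℂ)) / (β : ℂ) ^ 5)
      (𝓝[≠] (0 : ℝ)) (𝓝 (-Complex.I / 720)) := by
  have key := (Complex.continuous_ofReal.tendsto _ |>.comp tendsto_ig6_dissipation).sub
    ((Complex.continuous_ofReal.tendsto _ |>.comp tendsto_ig6_dispersion).const_mul Complex.I)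
  refine (key.congr fun β => ?_).trans_eq (by congr 1; push_cast; ring)
  simp only [FIG6, Function.comp_apply]
  push_cast
  ring
end

section
/- Let F^IG6(β) = (cos β - 1)²(cos³β - 7cos²β + 26cos β - 20)/(108(2cos β + 3)²) - i sin β (cos⁴β - 8cos³β + 105cos²β + 1070cos β + 1532)/(108(2cos β + 3)²). Then for every real β, Re F^IG6(β) = (cos β - 1)³(cos²β - 6cos β + 20)/(108(2cos β + 3)²) ≤ 0 (so IG6 is dissipative at every wavenumber), and the limit as β → 0 (β real, β ≠ 0) of Re F^IG6(β)/β⁶ equals -1/1440; in particular IG6 has a fifth-order dissipative error term, which IG4 does not have, so IG4 is less dissipative than IG6. -/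
open Filter Topology

theorem FIG6_re (β : ℝ) :
    (FIG6 β).re =
      (Real.cos β - 1) ^ 3 * ((Real.cos β) ^ 2 - 6 * Real.cos β + 20) /
        (108 * (2 * Real.cos β + 3) ^ 2) := by
  unfold FIG6
  rw [Complex.sub_re, Complex.ofReal_re, Complex.I_mul_re, Complex.ofReal_im]
  ring

theorem FIG6_re_nonpos (β : ℝ) : (FIG6 β).re ≤ 0 := by
  rw [FIG6_re]
  have hcos : Real.cos β - 1 ≤ 0 := by linarith [Real.cos_le_one β]
  have hquad : 0 ≤ (Real.cos β) ^ 2 - 6 * Real.cos β + 20 := by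
    nlinarith [sq_nonneg (Real.cos β - 3)]
  have hcube : (Real.cos β - 1) ^ 3 ≤ 0 := Odd.pow_nonpos (by decide) hcos
  exact div_nonpos_of_nonpos_of_nonneg (mul_nonpos_of_nonpos_of_nonneg hcube hquad)
    (by positivity)

theorem cos_sub_one_eq_sinc (β : ℝ) :
    Real.cos β - 1 = -(1 / 2) * Real.sinc (β / 2) ^ 2 * β ^ 2 := by
  rcases eq_or_ne β 0 with rfl | hβ
  · simp
  · rw [Real.sinc_of_ne_zero (by positivity)]
    have h := Real.cos_sq_add_sin_sq (β / 2)
    have h2 := Real.cos_two_mul (β / 2)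
    rw [mul_div_cancel₀ β two_ne_zero] at h2
    field_simp
    linarith

theorem tendsto_FIG6_re_div_pow_six :
    Tendsto (fun β : ℝ => (FIG6 β).re / β ^ 6) (𝓝[≠] (0 : ℝ)) (𝓝 (-1 / 1440 : ℝ)) := by
  have hcont : ContinuousAt (fun β : ℝ =>
      (-(1 / 2) * Real.sinc (β / 2) ^ 2) ^ 3 * ((Real.cos β) ^ 2 - 6 * Real.cos β + 20) /
        (108 * (2 * Real.cos β + 3) ^ 2)) 0 := by
    have hsinc : Continuous (fun β : ℝ => Real.sinc (β / 2)) :=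
      Real.continuous_sinc.comp (continuous_id.div_const 2)
    refine ContinuousAt.div (by fun_prop) (by fun_prop) ?_
    norm_num
  have hlim := hcont.tendsto.mono_left (nhdsWithin_le_nhds (s := {0}ᶜ))
  norm_num at hlim
  norm_num
  refine hlim.congr' ?_
  filter_upwards [self_mem_nhdsWithin] with β hβ
  have hβ : β ≠ 0 := hβ
  rw [FIG6_re, cos_sub_one_eq_sinc]
  have h6 : β ^ 6 ≠ 0 := pow_ne_zero 6 hβ
  rw [eq_div_iff h6]
  ring

/-- The IG6 scheme is dissipative at every wavenumber, with real part
(cos β - 1)³(cos²β - 6cos β + 20)/(108(2cos β + 3)²) ≤ 0, and has a fifth-order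
dissipative error: Re F^IG6(β)/β⁶ → -1/1440 as β → 0. -/
theorem ig6_dissipative_error :
    (∀ β : ℝ,
      (FIG6 β).re =
        (Real.cos β - 1) ^ 3 * ((Real.cos β) ^ 2 - 6 * Real.cos β + 20) /
          (108 * (2 * Real.cos β + 3) ^ 2) ∧
      (FIG6 β).re ≤ 0) ∧
    Tendsto (fun β : ℝ => (FIG6 β).re / β ^ 6)
      (𝓝[≠] (0 : ℝ)) (𝓝 (-1 / 1440 : ℝ)) := by
  exact ⟨fun β => ⟨FIG6_re β, FIG6_re_nonpos β⟩, tendsto_FIG6_re_div_pow_six⟩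
end
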